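/- arXiv:1411.3359 — 3 statements merged into one kernel-verified Lean document; each statement's English description precedes it below -/
import Mathlib

section
/- For every n ≥ 1 one has ê_n(μ) ≥ ê_n(ν) + p₀^{−1} Σ_{i=1}^N p_i log s_i. Consequently, if d₀ > 0, then Q̲₀^{d₀}(μ) ≥ exp(p₀^{−1} Σ_{i=1}^N p_i log s_i) · Q̲₀^{d₀}(ν). -/
open MeasureTheory Filter Metric

/-- The `n`-th geometric mean error (quantization error of order zero) of a Borel
probability measure `P` on `ℝ^q`. -/
noncomputable def geomError {q : ℕ} (P : Measure (EuclideanSpace ℝ (Fin q))) (n : ℕ) : ℝ :=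
  sInf {r : ℝ | ∃ α : Finset (EuclideanSpace ℝ (Fin q)), α.Nonempty ∧ α.card ≤ n ∧
    r = Real.exp (∫ x, Real.log (infDist x (↑α : Set (EuclideanSpace ℝ (Fin q)))) ∂P)}

/-- `ê_n(P)`, the logarithmic version of the `n`-th geometric mean error. -/
noncomputable def hatE {q : ℕ} (P : Measure (EuclideanSpace ℝ (Fin q))) (n : ℕ) : ℝ :=
  sInf {r : ℝ | ∃ α : Finset (EuclideanSpace ℝ (Fin q)), α.Nonempty ∧ α.card ≤ n ∧
    r = ∫ x, Real.log (infDist x (↑α : Set (EuclideanSpace ℝ (Fin q)))) ∂P}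



lemma meas_le {q : ℕ} (P : Measure (EuclideanSpace ℝ (Fin q))) (lam eta : ℝ)
    (hball : ∀ (x : EuclideanSpace ℝ (Fin q)) (ε : ℝ), 0 < ε → P (closedBall x ε) ≤ ENNReal.ofReal (lam * ε ^ eta))
    (α : Finset (EuclideanSpace ℝ (Fin q))) (hα : α.Nonempty) (n : ℕ) (hn : α.card ≤ n) (r : ℝ) (hr : 0 < r) :
    P {x | infDist x (↑α : Set (EuclideanSpace ℝ (Fin q))) ≤ r} ≤ n * ENNReal.ofReal (lam * r ^ eta) := by
  have hsub : {x | infDist x (↑α : Set (EuclideanSpace ℝ (Fin q))) ≤ r} ⊆ ⋃ a ∈ α, closedBall a r := by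
    intro x hx
    obtain ⟨a, ha, h⟩ := α.finite_toSet.isCompact.exists_infDist_eq_dist (by simpa using hα) x
    simp only [Set.mem_iUnion, mem_closedBall]
    refine ⟨a, by simpa using ha, ?_⟩
    rw [← h]; exact hx
  calc _ ≤ P (⋃ a ∈ α, closedBall a r) := measure_mono hsub
    _ ≤ ∑ a ∈ α, P (closedBall a r) := measure_biUnion_finset_le _ _
    _ ≤ ∑ a ∈ α, ENNReal.ofReal (lam * r ^ eta) := Finset.sum_le_sum fun a _ => hball a r hr
    _ = α.card * ENNReal.ofReal (lam * r ^ eta) := by simp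
    _ ≤ _ := by gcongr

noncomputable def Bd (lam eta : ℝ) : ENNReal :=
  ∑' k : ℕ, ENNReal.ofReal (lam * (Real.exp (-(k:ℝ))) ^ eta)

lemma Bd_ne_top (lam eta : ℝ) (hlam : 0 < lam) (heta : 0 < eta) : Bd lam eta ≠ ⊤ := by
  unfold Bd
  have h : ∀ k : ℕ, lam * (Real.exp (-(k:ℝ))) ^ eta = lam * (Real.exp (-eta)) ^ k := by
    intro k
    rw [← Real.exp_mul, ← Real.exp_nat_mul]
    congr 2; ring
  simp_rw [h]
  apply Summable.tsum_ofReal_ne_top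
  apply Summable.mul_left
  apply summable_geometric_of_lt_one (Real.exp_pos _).le
  rw [Real.exp_lt_one_iff]; linarith

lemma neg_part {q : ℕ} (P : Measure (EuclideanSpace ℝ (Fin q))) (lam eta : ℝ)
    (hball : ∀ (x : EuclideanSpace ℝ (Fin q)) (ε : ℝ), 0 < ε → P (closedBall x ε) ≤ ENNReal.ofReal (lam * ε ^ eta))
    (α : Finset (EuclideanSpace ℝ (Fin q))) (hα : α.Nonempty) (n : ℕ) (hn : α.card ≤ n) :
    ∫⁻ x, ENNReal.ofReal (-Real.log (infDist x (↑α : Set (EuclideanSpace ℝ (Fin q))))) ∂P ≤ n * Bd lam eta := by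
  have hpt : ∀ x : EuclideanSpace ℝ (Fin q), ENNReal.ofReal (-Real.log (infDist x (↑α : Set (EuclideanSpace ℝ (Fin q))))) ≤
      ∑' k : ℕ, Set.indicator {x | infDist x (↑α : Set (EuclideanSpace ℝ (Fin q))) ≤ Real.exp (-(k:ℝ))} 1 x := by
    intro x
    set d := infDist x (↑α : Set (EuclideanSpace ℝ (Fin q))) with hd
    rcases le_or_gt (-Real.log d) 0 with h | h
    · rw [ENNReal.ofReal_of_nonpos h]; exact zero_le
    have hd0 : 0 < d := by
      rcases (infDist_nonneg (x := x) (s := (↑α : Set (EuclideanSpace ℝ (Fin q))))).lt_or_eq with h' | h'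
      · exact h'
      · rw [← hd] at h'; rw [← h'] at h; simp at h
    set m := ⌈-Real.log d⌉₊
    calc ENNReal.ofReal (-Real.log d) ≤ ENNReal.ofReal (m : ℝ) :=
          ENNReal.ofReal_le_ofReal (Nat.le_ceil _)
      _ = ∑ k ∈ Finset.range m, (1 : ENNReal) := by simp
      _ = ∑ k ∈ Finset.range m,
          Set.indicator {x | infDist x (↑α : Set (EuclideanSpace ℝ (Fin q))) ≤ Real.exp (-(k:ℝ))} 1 x := by
        apply Finset.sum_congr rfl
        intro k hk
        have hk' : (k:ℝ) < -Real.log d := Nat.lt_ceil.1 (Finset.mem_range.1 hk)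
        rw [Set.indicator_of_mem]
        · rfl
        · change d ≤ _
          rw [← Real.log_le_iff_le_exp hd0]; linarith
      _ ≤ _ := ENNReal.sum_le_tsum _
  have hms : ∀ k : ℕ, MeasurableSet {x | infDist x (↑α : Set (EuclideanSpace ℝ (Fin q))) ≤ Real.exp (-(k:ℝ))} :=
    fun k => (isClosed_le (continuous_infDist_pt _) continuous_const).measurableSet
  calc _ ≤ ∫⁻ x, ∑' k : ℕ,
        Set.indicator {x | infDist x (↑α : Set (EuclideanSpace ℝ (Fin q))) ≤ Real.exp (-(k:ℝ))} 1 x ∂P :=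
        lintegral_mono hpt
    _ = ∑' k : ℕ, P {x | infDist x (↑α : Set (EuclideanSpace ℝ (Fin q))) ≤ Real.exp (-(k:ℝ))} := by
        rw [lintegral_tsum]
        · congr 1; ext k; exact lintegral_indicator_one (hms k)
        · intro k; exact (measurable_one.indicator (hms k)).aemeasurable
    _ ≤ ∑' k : ℕ, n * ENNReal.ofReal (lam * (Real.exp (-(k:ℝ))) ^ eta) :=
        ENNReal.tsum_le_tsum fun k => meas_le P lam eta hball α hα n hn _ (Real.exp_pos _)
    _ = _ := ENNReal.tsum_mul_left

lemma ae_pos {q : ℕ} (P : Measure (EuclideanSpace ℝ (Fin q))) (lam eta : ℝ) (hlam : 0 < lam) (heta : 0 < eta)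
    (hball : ∀ (x : EuclideanSpace ℝ (Fin q)) (ε : ℝ), 0 < ε → P (closedBall x ε) ≤ ENNReal.ofReal (lam * ε ^ eta))
    (α : Finset (EuclideanSpace ℝ (Fin q))) (hα : α.Nonempty) :
    ∀ᵐ x ∂P, infDist x (↑α : Set (EuclideanSpace ℝ (Fin q))) ≠ 0 := by
  rw [ae_iff]
  simp only [ne_eq, not_not]
  have h1 : ∀ k : ℕ, P {x | infDist x (↑α : Set (EuclideanSpace ℝ (Fin q))) = 0} ≤
      α.card * ENNReal.ofReal (lam * (Real.exp (-(k:ℝ))) ^ eta) := by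
    intro k
    refine le_trans (measure_mono ?_) (meas_le P lam eta hball α hα _ le_rfl _ (Real.exp_pos _))
    intro x hx
    have hx' : infDist x (↑α : Set (EuclideanSpace ℝ (Fin q))) = 0 := hx
    change infDist x (↑α : Set (EuclideanSpace ℝ (Fin q))) ≤ _
    rw [hx']; positivity
  have h2 := ENNReal.tendsto_atTop_zero_of_tsum_ne_top (Bd_ne_top lam eta hlam heta)
  have h3 := ENNReal.Tendsto.const_mul (a := (α.card : ENNReal)) h2 (Or.inr (by simp))
  rw [mul_zero] at h3
  exact le_antisymm (ge_of_tendsto' h3 h1) zero_le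

lemma integ {q : ℕ} (P : Measure (EuclideanSpace ℝ (Fin q))) [IsProbabilityMeasure P]
    (hc : ∃ K : Set (EuclideanSpace ℝ (Fin q)), IsCompact K ∧ P Kᶜ = 0)
    (lam eta : ℝ) (hlam : 0 < lam) (heta : 0 < eta)
    (hball : ∀ (x : EuclideanSpace ℝ (Fin q)) (ε : ℝ), 0 < ε → P (closedBall x ε) ≤ ENNReal.ofReal (lam * ε ^ eta))
    (α : Finset (EuclideanSpace ℝ (Fin q))) (hα : α.Nonempty) :
    Integrable (fun x => Real.log (infDist x (↑α : Set (EuclideanSpace ℝ (Fin q))))) P := by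
  obtain ⟨K, hK, hK0⟩ := hc
  have hm : Measurable (fun x => Real.log (infDist x (↑α : Set (EuclideanSpace ℝ (Fin q))))) :=
    Real.measurable_log.comp (continuous_infDist_pt _).measurable
  refine ⟨hm.aestronglyMeasurable, ?_⟩
  rw [hasFiniteIntegral_iff_enorm]
  obtain ⟨M, hM⟩ := hK.exists_bound_of_continuousOn
    (f := fun x => infDist x (↑α : Set (EuclideanSpace ℝ (Fin q)))) (continuous_infDist_pt _).continuousOn
  have hae : ∀ᵐ x ∂P, ‖Real.log (infDist x (↑α : Set (EuclideanSpace ℝ (Fin q))))‖ₑ ≤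
      ENNReal.ofReal (-Real.log (infDist x (↑α : Set (EuclideanSpace ℝ (Fin q))))) + ENNReal.ofReal M := by
    have : ∀ᵐ x ∂P, x ∈ K := by rw [ae_iff]; exact hK0
    filter_upwards [this] with x hx
    have h1 := hM x hx
    have h2 := infDist_nonneg (x := x) (s := (↑α : Set (EuclideanSpace ℝ (Fin q))))
    rw [Real.norm_of_nonneg h2] at h1
    have h3 := Real.log_le_self h2
    rw [← ofReal_norm_eq_enorm, Real.norm_eq_abs]
    rcases le_total 0 (Real.log (infDist x (↑α : Set (EuclideanSpace ℝ (Fin q))))) with h | h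
    · rw [abs_of_nonneg h]
      exact le_trans (ENNReal.ofReal_le_ofReal (h3.trans h1)) le_add_self
    · rw [abs_of_nonpos h]; exact le_self_add
  calc _ ≤ ∫⁻ x, (ENNReal.ofReal (-Real.log (infDist x (↑α : Set (EuclideanSpace ℝ (Fin q))))) + ENNReal.ofReal M) ∂P :=
        lintegral_mono_ae hae
    _ = ∫⁻ x, ENNReal.ofReal (-Real.log (infDist x (↑α : Set (EuclideanSpace ℝ (Fin q))))) ∂P + ENNReal.ofReal M := by
        rw [lintegral_add_right _ measurable_const]; simp
    _ ≤ α.card * Bd lam eta + ENNReal.ofReal M := by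
        gcongr; exact neg_part P lam eta hball α hα _ le_rfl
    _ < ⊤ := ENNReal.add_lt_top.2 ⟨ENNReal.mul_lt_top (by simp)
        (Bd_ne_top lam eta hlam heta).lt_top, ENNReal.ofReal_lt_top⟩

def hatSet {q : ℕ} (P : Measure (EuclideanSpace ℝ (Fin q))) (n : ℕ) : Set ℝ :=
  {r : ℝ | ∃ α : Finset (EuclideanSpace ℝ (Fin q)), α.Nonempty ∧ α.card ≤ n ∧
    r = ∫ x, Real.log (infDist x (↑α : Set (EuclideanSpace ℝ (Fin q)))) ∂P}

lemma hatSet_nonempty {q : ℕ} (P : Measure (EuclideanSpace ℝ (Fin q))) (n : ℕ) (hn : 1 ≤ n) :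
    (hatSet P n).Nonempty :=
  ⟨_, {0}, by simp, by simpa using hn, rfl⟩

lemma hatSet_bdd {q : ℕ} (P : Measure (EuclideanSpace ℝ (Fin q))) [IsProbabilityMeasure P]
    (hc : ∃ K : Set (EuclideanSpace ℝ (Fin q)), IsCompact K ∧ P Kᶜ = 0)
    (lam eta : ℝ) (hlam : 0 < lam) (heta : 0 < eta)
    (hball : ∀ (x : EuclideanSpace ℝ (Fin q)) (ε : ℝ), 0 < ε → P (closedBall x ε) ≤ ENNReal.ofReal (lam * ε ^ eta))
    (n : ℕ) : BddBelow (hatSet P n) := by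
  refine ⟨-(n * Bd lam eta).toReal, ?_⟩
  rintro r ⟨α, hα, hn, rfl⟩
  have hi := integ P hc lam eta hlam heta hball α hα
  rw [integral_eq_lintegral_pos_part_sub_lintegral_neg_part hi]
  have h1 := neg_part P lam eta hball α hα n hn
  have h2 := ENNReal.toReal_mono (ENNReal.mul_ne_top (by simp) (Bd_ne_top lam eta hlam heta)) h1
  have h3 : 0 ≤ (∫⁻ x, ENNReal.ofReal (Real.log (infDist x (↑α : Set (EuclideanSpace ℝ (Fin q))))) ∂P).toReal :=
    ENNReal.toReal_nonneg
  linarith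

lemma geom_eq {q : ℕ} (P : Measure (EuclideanSpace ℝ (Fin q))) (n : ℕ) (hn : 1 ≤ n) (hb : BddBelow (hatSet P n)) :
    geomError P n = Real.exp (hatE P n) := by
  have h := Real.exp_monotone.map_csInf_of_continuousAt
    (Real.continuous_exp.continuousAt) (hatSet_nonempty P n hn) hb
  change _ = Real.exp (sInf (hatSet P n))
  rw [h]
  unfold geomError hatSet
  congr 1
  ext r
  constructor
  · rintro ⟨α, h1, h2, rfl⟩
    exact ⟨_, ⟨α, h1, h2, rfl⟩, rfl⟩
  · rintro ⟨_, ⟨α, h1, h2, rfl⟩, rfl⟩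
    exact ⟨α, h1, h2, rfl⟩

lemma sim_surj {q : ℕ} (f : (EuclideanSpace ℝ (Fin q)) → (EuclideanSpace ℝ (Fin q))) (s : ℝ) (hs : 0 < s)
    (hf : ∀ x y, dist (f x) (f y) = s * dist x y) : Function.Surjective f := by
  have hiso : Isometry (fun x => s⁻¹ • f x) := by
    apply Isometry.of_dist_eq
    intro x y
    rw [dist_smul₀, hf, Real.norm_of_nonneg (by positivity)]
    field_simp
  let g := hiso.affineIsometryOfStrictConvexSpace
  have hg : Function.Surjective g.linearIsometry :=
    LinearMap.surjective_of_injective (f := g.linearIsometry.toLinearMap) g.linearIsometry.injective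
  have hg' : Function.Surjective g.toAffineMap := by
    rw [← AffineMap.linear_surjective_iff]; exact hg
  intro y
  obtain ⟨x, hx⟩ := hg' (s⁻¹ • y)
  refine ⟨x, ?_⟩
  have hx' : s⁻¹ • f x = s⁻¹ • y := hx
  exact smul_right_injective _ (inv_ne_zero hs.ne') hx'

lemma infDist_sim {q : ℕ} (f g : (EuclideanSpace ℝ (Fin q)) → (EuclideanSpace ℝ (Fin q))) (s : ℝ) (hs : 0 < s)
    (hf : ∀ x y, dist (f x) (f y) = s * dist x y) (hg : ∀ y, f (g y) = y)
    (α β : Finset (EuclideanSpace ℝ (Fin q))) (hα : α.Nonempty) (hβ : (β : Set (EuclideanSpace ℝ (Fin q))) = g '' α) (x : EuclideanSpace ℝ (Fin q)) :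
    infDist (f x) (↑α : Set (EuclideanSpace ℝ (Fin q))) = s * infDist x (↑β : Set (EuclideanSpace ℝ (Fin q))) := by
  apply le_antisymm
  · obtain ⟨b, hb, h⟩ := β.finite_toSet.isCompact.exists_infDist_eq_dist
      (by rw [hβ]; exact Set.Nonempty.image _ (by simpa using hα)) x
    rw [hβ] at hb
    obtain ⟨a, ha, rfl⟩ := hb
    rw [h, ← hf, hg]
    exact infDist_le_dist_of_mem ha
  · obtain ⟨a, ha, h⟩ := α.finite_toSet.isCompact.exists_infDist_eq_dist (by simpa using hα) (f x)
    rw [h, ← hg a, hf]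
    gcongr
    apply infDist_le_dist_of_mem
    rw [hβ]; exact ⟨a, ha, rfl⟩

theorem stmt5 (q N : ℕ) (hq : 1 ≤ q) (hN : 1 ≤ N)
    (f : Fin N → EuclideanSpace ℝ (Fin q) → EuclideanSpace ℝ (Fin q))
    (s : Fin N → ℝ) (hs : ∀ i, s i ∈ Set.Ioo (0 : ℝ) 1)
    (hf : ∀ i x y, dist (f i x) (f i y) = s i * dist x y)
    (p : Fin (N + 1) → ℝ) (hp : ∀ i, 0 < p i) (hpsum : ∑ i, p i = 1)
    (ν : Measure (EuclideanSpace ℝ (Fin q))) (hνp : IsProbabilityMeasure ν)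
    (hνc : ∃ K : Set (EuclideanSpace ℝ (Fin q)), IsCompact K ∧ ν Kᶜ = 0)
    (μ : Measure (EuclideanSpace ℝ (Fin q))) (hμp : IsProbabilityMeasure μ)
    (hμc : ∃ K : Set (EuclideanSpace ℝ (Fin q)), IsCompact K ∧ μ Kᶜ = 0)
    (hμ : μ = ENNReal.ofReal (p 0) • ν + ∑ i : Fin N, ENNReal.ofReal (p i.succ) • μ.map (f i))
    (lam eta : ℝ) (hlam : 0 < lam) (heta : 0 < eta)
    (hball : ∀ (x : EuclideanSpace ℝ (Fin q)) (ε : ℝ), 0 < ε →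
      ν (closedBall x ε) ≤ ENNReal.ofReal (lam * ε ^ eta) ∧
      μ (closedBall x ε) ≤ ENNReal.ofReal (lam * ε ^ eta)) :
    (∀ n : ℕ, 1 ≤ n →
      hatE ν n + (p 0)⁻¹ * ∑ i : Fin N, p i.succ * Real.log (s i) ≤ hatE μ n) ∧
    ∀ d₀ : ℝ, 0 < d₀ →
      ENNReal.ofReal (Real.exp ((p 0)⁻¹ * ∑ i : Fin N, p i.succ * Real.log (s i))) *
          liminf (fun n : ℕ => ENNReal.ofReal ((n : ℝ) ^ (1 / d₀) * geomError ν n)) atTop ≤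
        liminf (fun n : ℕ => ENNReal.ofReal ((n : ℝ) ^ (1 / d₀) * geomError μ n)) atTop := by
  have hνb := fun x ε h => (hball x ε h).1
  have hμb := fun x ε h => (hball x ε h).2
  have hsum : ∑ i : Fin N, p i.succ = 1 - p 0 := by
    rw [Fin.sum_univ_succ] at hpsum; linarith
  have key : ∀ n : ℕ, 1 ≤ n →
      hatE ν n + (p 0)⁻¹ * ∑ i : Fin N, p i.succ * Real.log (s i) ≤ hatE μ n := by
    intro n hn
    have hbμ := hatSet_bdd μ hμc lam eta hlam heta hμb n
    have hbν := hatSet_bdd ν hνc lam eta hlam heta hνb n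
    have hmain : p 0 * hatE ν n + ∑ i : Fin N, p i.succ * Real.log (s i)
        + (1 - p 0) * hatE μ n ≤ hatE μ n := by
      refine le_csInf (hatSet_nonempty μ n hn) ?_
      rintro r ⟨α, hα, hαn, rfl⟩
      set L : EuclideanSpace ℝ (Fin q) → ℝ :=
        fun x => Real.log (infDist x (↑α : Set (EuclideanSpace ℝ (Fin q)))) with hL
      have hLm : Measurable L := Real.measurable_log.comp (continuous_infDist_pt _).measurable
      have hfm : ∀ i, Measurable (f i) := fun i =>
        (LipschitzWith.of_dist_le_mul (K := ⟨s i, (hs i).1.le⟩)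
          (fun x y => (hf i x y).le)).continuous.measurable
      have hi : ∀ i, Integrable L (μ.map (f i)) ∧
          Real.log (s i) + hatE μ n ≤ ∫ x, L x ∂(μ.map (f i)) := by
        intro i
        obtain ⟨g, hg⟩ := (sim_surj (f i) (s i) (hs i).1 (hf i)).hasRightInverse
        classical
        let β := α.image g
        have hβ : β.Nonempty := hα.image g
        have hβn : β.card ≤ n := Finset.card_image_le.trans hαn
        have hβI := integ μ hμc lam eta hlam heta hμb β hβ
        have hae : (L ∘ f i) =ᵐ[μ] fun x => Real.log (s i) +
            Real.log (infDist x (↑β : Set (EuclideanSpace ℝ (Fin q)))) := by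
          filter_upwards [ae_pos μ lam eta hlam heta hμb β hβ] with x hx
          simp only [hL, Function.comp]
          rw [infDist_sim (f i) g (s i) (hs i).1 (hf i) hg α β hα (by simp [β]) x,
            Real.log_mul (hs i).1.ne' hx]
        have hI : Integrable (L ∘ f i) μ := ((integrable_const _).add hβI).congr hae.symm
        refine ⟨(integrable_map_measure hLm.aestronglyMeasurable (hfm i).aemeasurable).2 hI, ?_⟩
        rw [integral_map (hfm i).aemeasurable hLm.aestronglyMeasurable]
        change _ ≤ ∫ x, (L ∘ f i) x ∂μ
        rw [integral_congr_ae hae, integral_add (integrable_const _) hβI]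
        have : hatE μ n ≤ ∫ x, Real.log (infDist x (↑β : Set (EuclideanSpace ℝ (Fin q)))) ∂μ :=
          csInf_le hbμ ⟨β, hβ, hβn, rfl⟩
        simpa using this
      have hνI : Integrable L ν := integ ν hνc lam eta hlam heta hνb α hα
      have hνle : hatE ν n ≤ ∫ x, L x ∂ν := csInf_le hbν ⟨α, hα, hαn, rfl⟩
      have hexp : ∫ x, L x ∂μ = p 0 * ∫ x, L x ∂ν +
          ∑ i : Fin N, p i.succ * ∫ x, L x ∂(μ.map (f i)) := by
        have h1 : ∫ x, L x ∂μ = ∫ x, L x ∂(ENNReal.ofReal (p 0) • ν +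
          ∑ i : Fin N, ENNReal.ofReal (p i.succ) • μ.map (f i)) :=
          congrArg (fun m => ∫ x, L x ∂m) hμ
        have hi' : ∀ i ∈ Finset.univ, Integrable L (ENNReal.ofReal (p (Fin.succ i)) • μ.map (f i)) :=
          fun i _ => (hi i).1.smul_measure ENNReal.ofReal_ne_top
        rw [h1, integral_add_measure (hνI.smul_measure ENNReal.ofReal_ne_top)
          (integrable_finsetSum_measure.2 hi'), integral_finsetSum_measure hi']
        simp only [integral_smul_measure, ENNReal.toReal_ofReal (hp _).le, smul_eq_mul]
      rw [hexp, ← hsum, Finset.sum_mul, add_assoc, ← Finset.sum_add_distrib]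
      refine add_le_add (mul_le_mul_of_nonneg_left hνle (hp 0).le) (Finset.sum_le_sum ?_)
      intro i _
      rw [← mul_add]
      exact mul_le_mul_of_nonneg_left (hi i).2 (hp _).le
    have hp0 := hp 0
    have h2 : p 0 * (hatE ν n + (p 0)⁻¹ * ∑ i : Fin N, p i.succ * Real.log (s i)) ≤
        p 0 * hatE μ n := by
      rw [mul_add, mul_inv_cancel_left₀ hp0.ne']; linarith
    exact le_of_mul_le_mul_left h2 hp0
  refine ⟨key, fun d₀ hd₀ => ?_⟩
  rw [← ENNReal.liminf_const_mul_of_ne_top ENNReal.ofReal_ne_top]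
  refine liminf_le_liminf ?_
  filter_upwards [eventually_ge_atTop 1] with n hn
  rw [← ENNReal.ofReal_mul (Real.exp_pos _).le]
  apply ENNReal.ofReal_le_ofReal
  rw [geom_eq μ n hn (hatSet_bdd μ hμc lam eta hlam heta hμb n),
    geom_eq ν n hn (hatSet_bdd ν hνc lam eta hlam heta hνb n), mul_left_comm, ← Real.exp_add]
  gcongr
  rw [add_comm]
  exact key n hn
end

section
/- There exists a constant C₂ > 0 such that for all j ≥ 1, |Σ_{σ∈Λ_j} p_σ log t_σ| ≤ C₂ and |Σ_{σ∈Λ_j} p_σ log s_σ| ≤ C₂. -/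
/-- `p_σ = ∏_h p_{σ_h}` for a word `σ` over the alphabet `{1,…,N}`
(letter `i ∈ {1,…,N}` carries weight `p i`, where `p` is indexed by `{0,1,…,N}`). -/
def pword {N : ℕ} (p : Fin (N + 1) → ℝ) (σ : List (Fin N)) : ℝ :=
  (σ.map fun i => p i.succ).prod

/-- `a_σ = ∏_h a_{σ_h}` for a word `σ` over the alphabet `{1,…,N}`. -/
def aword {N : ℕ} (a : Fin N → ℝ) (σ : List (Fin N)) : ℝ := (σ.map a).prod

/-- The finite maximal antichain `Λ_j = {σ ∈ Ω^* : t_{σ⁻} ≥ t̲^j > t_σ}`,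
where `t̲ = min_i t_i`. -/
def Lam {N : ℕ} (t : Fin N → ℝ) (j : ℕ) : Set (List (Fin N)) :=
  {σ | σ ≠ [] ∧ (⨅ i, t i) ^ j ≤ aword t σ.dropLast ∧ aword t σ < (⨅ i, t i) ^ j}

theorem aux_sum {N : ℕ} (w : Fin N → ℝ) (hw : ∀ i, 0 ≤ w i) (hQ : ∑ i, w i < 1) (K : ℕ) :
    ∀ F : Finset (List (Fin N)), (∀ σ ∈ F, σ.length ≤ K) →
      ∑ σ ∈ F, (σ.map w).prod ≤ 1 / (1 - ∑ i, w i) := by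
  classical
  have hQ0 : 0 ≤ ∑ i, w i := Finset.sum_nonneg fun i _ => hw i
  have hnn : ∀ σ : List (Fin N), 0 ≤ (σ.map w).prod := by
    intro σ
    apply List.prod_nonneg
    intro a ha
    obtain ⟨i, _, rfl⟩ := List.mem_map.1 ha
    exact hw i
  have h1Q : 0 < 1 - ∑ i, w i := by linarith
  induction K with
  | zero =>
    intro F hF
    have hsub : F ⊆ {[]} := by
      intro σ hσ
      have := hF σ hσ
      simpa using this
    calc ∑ σ ∈ F, (σ.map w).prod ≤ ∑ σ ∈ {([] : List (Fin N))}, (σ.map w).prod :=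
          Finset.sum_le_sum_of_subset_of_nonneg hsub fun σ _ _ => hnn σ
      _ = 1 := by simp
      _ ≤ _ := by rw [le_div_iff₀ h1Q]; linarith
  | succ K ih =>
    intro F hF
    let G := F.image List.tail
    have hG := ih G (by
      intro σ hσ
      obtain ⟨τ, hτ, rfl⟩ := Finset.mem_image.1 hσ
      have := hF τ hτ
      simp
      omega)
    let H := ((Finset.univ : Finset (Fin N)) ×ˢ G).image fun x => x.1 :: x.2
    have hsub : F ⊆ insert [] H := by
      intro σ hσ
      cases σ with
      | nil => simp
      | cons i τ =>
        apply Finset.mem_insert_of_mem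
        refine Finset.mem_image.2 ⟨(i, τ), ?_, rfl⟩
        simp only [Finset.mem_product, Finset.mem_univ, true_and]
        exact Finset.mem_image.2 ⟨_, hσ, rfl⟩
    have hH : ∑ σ ∈ H, (σ.map w).prod = (∑ i, w i) * ∑ σ ∈ G, (σ.map w).prod := by
      rw [Finset.sum_image]
      · rw [Finset.sum_mul_sum, Finset.sum_product]
        simp
      · rintro ⟨a, b⟩ _ ⟨c, d⟩ _ h
        simpa using h
    calc ∑ σ ∈ F, (σ.map w).prod ≤ ∑ σ ∈ insert [] H, (σ.map w).prod :=
          Finset.sum_le_sum_of_subset_of_nonneg hsub fun σ _ _ => hnn σ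
      _ = 1 + (∑ i, w i) * ∑ σ ∈ G, (σ.map w).prod := by
          rw [Finset.sum_insert, hH]
          · simp
          · simp [H]
      _ ≤ 1 + (∑ i, w i) * (1 / (1 - ∑ i, w i)) := by gcongr
      _ = _ := by field_simp; ring

theorem aux_finsum {α : Type*} (S : Set α) (f : α → ℝ) (C : ℝ)
    (h : ∀ F : Finset α, ∑ a ∈ F, |f a| ≤ C) : |∑ᶠ a ∈ S, f a| ≤ C := by
  classical
  rw [finsum_mem_def, finsum_def]
  split_ifs with hf
  · refine (Finset.abs_sum_le_sum_abs _ _).trans ((Finset.sum_le_sum ?_).trans (h _))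
    intro a _
    by_cases ha : a ∈ S <;> simp [ha]
  · simpa using h ∅

theorem aux_log {N : ℕ} (a : Fin N → ℝ) (ha : ∀ i, 0 < a i) (σ : List (Fin N)) :
    |Real.log (aword a σ)| ≤ (∑ i, |Real.log (a i)|) * σ.length := by
  induction σ with
  | nil => simp [aword]
  | cons i τ ih =>
    have hpos : 0 < aword a τ := by
      apply List.prod_pos
      intro x hx
      obtain ⟨k, _, rfl⟩ := List.mem_map.1 hx
      exact ha k
    have h1 : aword a (i :: τ) = a i * aword a τ := by simp [aword]
    rw [h1, Real.log_mul (ha i).ne' hpos.ne']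
    have h2 : |Real.log (a i)| ≤ ∑ i, |Real.log (a i)| :=
      Finset.single_le_sum (f := fun i => |Real.log (a i)|) (fun _ _ => abs_nonneg _)
        (Finset.mem_univ i)
    have h3 := abs_add_le (Real.log (a i)) (Real.log (aword a τ))
    push_cast [List.length_cons]
    linarith

theorem aux_main {N : ℕ} (p : Fin (N + 1) → ℝ) (hp : ∀ i, 0 < p i) (hpsum : ∑ i, p i = 1)
    (a : Fin N → ℝ) (ha : ∀ i, 0 < a i) :
    ∃ C : ℝ, ∀ S : Set (List (Fin N)),
      |∑ᶠ σ ∈ S, pword p σ * Real.log (aword a σ)| ≤ C := by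
  classical
  obtain ⟨q, hq⟩ : ∃ q, q = ∑ i : Fin N, p i.succ := ⟨_, rfl⟩
  have hq0 : 0 ≤ q := hq ▸ Finset.sum_nonneg fun i _ => (hp _).le
  have hq1 : q < 1 := by
    rw [Fin.sum_univ_succ, ← hq] at hpsum
    linarith [hp 0]
  obtain ⟨r, hr⟩ : ∃ r, r = 2 / (1 + q) := ⟨_, rfl⟩
  have hr1 : 1 < r := by rw [hr, lt_div_iff₀ (by linarith)]; linarith
  have hQ : ∑ i : Fin N, p i.succ * r = q * r := by rw [← Finset.sum_mul, hq]
  have hQ1 : q * r < 1 := by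
    rw [hr, ← mul_div_assoc, div_lt_one (by linarith)]; linarith
  obtain ⟨M, hM⟩ : ∃ M, M = ∑ i, |Real.log (a i)| := ⟨_, rfl⟩
  have hM0 : 0 ≤ M := hM ▸ Finset.sum_nonneg fun i _ => abs_nonneg _
  refine ⟨M / (r - 1) * (1 / (1 - q * r)), fun S => aux_finsum _ _ _ fun F => ?_⟩
  have key : ∀ σ : List (Fin N), |pword p σ * Real.log (aword a σ)| ≤
      M / (r - 1) * (σ.map fun i => p i.succ * r).prod := by
    intro σ
    have h1 : (σ.map fun i => p i.succ * r).prod = pword p σ * r ^ σ.length := by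
      rw [List.prod_map_mul]; simp [pword]
    have h2 : 0 ≤ pword p σ := by
      apply List.prod_nonneg
      intro x hx
      obtain ⟨k, _, rfl⟩ := List.mem_map.1 hx
      exact (hp _).le
    have h3 := aux_log a ha σ
    rw [← hM] at h3
    have h4 := one_add_mul_sub_le_pow (a := r) (by linarith) σ.length
    have h5 : (σ.length : ℝ) ≤ r ^ σ.length / (r - 1) := by
      rw [le_div_iff₀ (by linarith)]; linarith
    rw [abs_mul, abs_of_nonneg h2, h1]
    calc pword p σ * |Real.log (aword a σ)| ≤ pword p σ * (M * (r ^ σ.length / (r - 1))) := by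
          gcongr
          exact h3.trans (by gcongr)
      _ = _ := by ring
  calc _ ≤ ∑ σ ∈ F, M / (r - 1) * (σ.map fun i => p i.succ * r).prod :=
        Finset.sum_le_sum fun σ _ => key σ
    _ = M / (r - 1) * ∑ σ ∈ F, (σ.map fun i => p i.succ * r).prod := by rw [Finset.mul_sum]
    _ ≤ _ := by
      have h := aux_sum (fun i : Fin N => p i.succ * r)
        (fun i => mul_nonneg (hp _).le (by linarith)) (by rw [hQ]; exact hQ1)
        (F.sup List.length) F (fun σ hσ => Finset.le_sup (f := List.length) hσ)
      rw [hQ] at h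
      exact mul_le_mul_of_nonneg_left h (div_nonneg hM0 (by linarith))


theorem stmt12 (N : ℕ) (hN : 2 ≤ N)
    (p : Fin (N + 1) → ℝ) (hp : ∀ i, 0 < p i) (hpsum : ∑ i, p i = 1)
    (t : Fin N → ℝ) (ht : ∀ i, 0 < t i) (htsum : ∑ i, t i = 1)
    (s : Fin N → ℝ) (hs : ∀ i, s i ∈ Set.Ioo (0 : ℝ) 1) :
    ∃ C₂ : ℝ, 0 < C₂ ∧ ∀ j : ℕ, 1 ≤ j →
      |∑ᶠ σ ∈ Lam t j, pword p σ * Real.log (aword t σ)| ≤ C₂ ∧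
      |∑ᶠ σ ∈ Lam t j, pword p σ * Real.log (aword s σ)| ≤ C₂ := by

  obtain ⟨A, hA⟩ := aux_main p hp hpsum t ht
  obtain ⟨B, hB⟩ := aux_main p hp hpsum s (fun i => (hs i).1)
  refine ⟨max 1 (max A B), by positivity, fun j _ => ⟨(hA _).trans ?_, (hB _).trans ?_⟩⟩
  · exact (le_max_left _ _).trans (le_max_right _ _)
  · exact (le_max_right _ _).trans (le_max_right _ _)
end

section
/- For every σ ∈ Ω* and every h ≥ 1: Σ_{τ∈Γ(σ,h)} μ⁽¹⁾(τ) log t_τ = μ⁽¹⁾(σ) log t_σ + Δ₁(σ,h), and Σ_{τ∈Γ(σ,h)} μ⁽¹⁾(τ) log s_τ = μ⁽¹⁾(σ) log s_σ + Δ₂(σ,h). -/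
/-- `μ⁽¹⁾(σ) = Σ_{h=0}^{|σ|-1} p₀ p_{σ|_h} t_{σ^{(l)}_{-h}}`. -/
def mu1 {N : ℕ} (p : Fin (N + 1) → ℝ) (t : Fin N → ℝ) (σ : List (Fin N)) : ℝ :=
  ∑ h ∈ Finset.range σ.length, p 0 * pword p (σ.take h) * aword t (σ.drop h)

/-- The quantity `Δ(σ,h)`: taking `w = t` it gives `Δ₁(σ,h)` (with
`u₀ = Σ_i t_i log t_i`, `log t_σ`, `Σ_i p_i log t_i`), and taking `w = s` it
gives `Δ₂(σ,h)` (with `l₀ = Σ_i t_i log s_i`, `log s_σ`, `Σ_i p_i log s_i`).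
Sums `Σ_{l=2}^h` are empty when `h = 1`. -/
noncomputable def Delta {N : ℕ} (p : Fin (N + 1) → ℝ) (t : Fin N → ℝ) (w : Fin N → ℝ)
    (σ : List (Fin N)) (h : ℕ) : ℝ :=
  (∑ i, t i * Real.log (w i)) *
      (∑ l ∈ Finset.Icc 2 h,
        (mu1 p t σ + pword p σ * (1 - p 0) * (1 - (1 - p 0) ^ (l - 2)) + p 0 * pword p σ))
    + (∑ i, t i * Real.log (w i)) * (mu1 p t σ + p 0 * pword p σ)
    + pword p σ * Real.log (aword w σ) * ((1 - p 0) * (1 - (1 - p 0) ^ (h - 1)))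
    + p 0 * pword p σ * Real.log (aword w σ)
    + p 0 * pword p σ * (∑ l ∈ Finset.Icc 2 h, ((l : ℝ) - 1) * (1 - p 0) ^ (l - 2)) *
        (∑ i, p i.succ * Real.log (w i))
    + (∑ i, t i * Real.log (w i)) * (pword p σ * (1 - p 0) * (1 - (1 - p 0) ^ (h - 1)))

theorem sum_ext_step {N : ℕ} (F : List (Fin N) → ℝ) (σ : List (Fin N)) (h : ℕ) :
    ∑ ω : Fin (h + 1) → Fin N, F (σ ++ List.ofFn ω) =
      ∑ ω : Fin h → Fin N, ∑ i, F ((σ ++ List.ofFn ω) ++ [i]) := by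
  rw [← (Fin.snocEquiv (fun _ : Fin (h + 1) => Fin N)).sum_comp, Fintype.sum_prod_type,
    Finset.sum_comm]
  refine Finset.sum_congr rfl fun ω _ => Finset.sum_congr rfl fun i _ => ?_
  congr 1
  rw [List.ofFn_succ']
  simp [Fin.snocEquiv, List.concat_eq_append]

theorem pword_snoc {N : ℕ} (p : Fin (N + 1) → ℝ) (τ : List (Fin N)) (i : Fin N) :
    pword p (τ ++ [i]) = pword p τ * p i.succ := by simp [pword]

theorem aword_snoc {N : ℕ} (a : Fin N → ℝ) (τ : List (Fin N)) (i : Fin N) :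
    aword a (τ ++ [i]) = aword a τ * a i := by simp [aword]

theorem aword_pos {N : ℕ} (a : Fin N → ℝ) (ha : ∀ i, 0 < a i) (τ : List (Fin N)) :
    0 < aword a τ := by
  unfold aword
  apply List.prod_pos
  intro x hx
  obtain ⟨i, _, rfl⟩ := List.mem_map.1 hx
  exact ha i

theorem log_snoc {N : ℕ} (a : Fin N → ℝ) (ha : ∀ i, 0 < a i) (τ : List (Fin N)) (i : Fin N) :
    Real.log (aword a (τ ++ [i])) = Real.log (aword a τ) + Real.log (a i) := by
  rw [aword_snoc, Real.log_mul (aword_pos a ha τ).ne' (ha i).ne']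

theorem mu1_snoc {N : ℕ} (p : Fin (N + 1) → ℝ) (t : Fin N → ℝ) (τ : List (Fin N)) (i : Fin N) :
    mu1 p t (τ ++ [i]) = (mu1 p t τ + p 0 * pword p τ) * t i := by
  unfold mu1
  rw [List.length_append, List.length_singleton, Finset.sum_range_succ, add_mul, Finset.sum_mul]
  congr 1
  · refine Finset.sum_congr rfl fun h hh => ?_
    have hh' : h ≤ τ.length := (Finset.mem_range.1 hh).le
    rw [List.take_append_of_le_length hh', List.drop_append_of_le_length hh', aword_snoc]
    ring
  · simp [aword]

section
variable {N : ℕ} (p : Fin (N + 1) → ℝ) (t w : Fin N → ℝ)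

theorem sumP (hq : ∑ i : Fin N, p i.succ = 1 - p 0) (σ : List (Fin N)) (h : ℕ) :
    ∑ ω : Fin h → Fin N, pword p (σ ++ List.ofFn ω) = pword p σ * (1 - p 0) ^ h := by
  induction h with
  | zero => simp
  | succ h ih =>
    rw [sum_ext_step (pword p)]
    simp only [pword_snoc, ← Finset.mul_sum, hq]
    rw [← Finset.sum_mul, ih]; ring

theorem sumM (hq : ∑ i : Fin N, p i.succ = 1 - p 0) (htsum : ∑ i, t i = 1)
    (σ : List (Fin N)) (h : ℕ) :
    ∑ ω : Fin h → Fin N, mu1 p t (σ ++ List.ofFn ω) =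
      mu1 p t σ + pword p σ * (1 - (1 - p 0) ^ h) := by
  induction h with
  | zero => simp
  | succ h ih =>
    rw [sum_ext_step (mu1 p t)]
    simp only [mu1_snoc, ← Finset.mul_sum, htsum, mul_one]
    rw [Finset.sum_add_distrib, ← Finset.mul_sum, ih, sumP p hq]; ring

theorem sumK (hq : ∑ i : Fin N, p i.succ = 1 - p 0) (hw : ∀ i, 0 < w i)
    (σ : List (Fin N)) (h : ℕ) :
    ∑ ω : Fin h → Fin N, pword p (σ ++ List.ofFn ω) * Real.log (aword w (σ ++ List.ofFn ω)) =
      pword p σ * ((1 - p 0) ^ h * Real.log (aword w σ) +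
        h * (1 - p 0) ^ (h - 1) * ∑ i, p i.succ * Real.log (w i)) := by
  induction h with
  | zero => simp
  | succ h ih =>
    rw [sum_ext_step (fun τ => pword p τ * Real.log (aword w τ))]
    have key : ∀ τ : List (Fin N),
        ∑ i, pword p (τ ++ [i]) * Real.log (aword w (τ ++ [i])) =
        (1 - p 0) * (pword p τ * Real.log (aword w τ)) +
          pword p τ * ∑ i, p i.succ * Real.log (w i) := by
      intro τ
      rw [← hq, Finset.sum_mul, Finset.mul_sum, ← Finset.sum_add_distrib]
      refine Finset.sum_congr rfl fun i _ => ?_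
      rw [pword_snoc, log_snoc w hw]; ring
    simp only [key]
    rw [Finset.sum_add_distrib, ← Finset.mul_sum, ← Finset.sum_mul, ih, sumP p hq]
    rcases h with _ | k
    · simp; ring
    · simp only [Nat.add_sub_cancel]; push_cast; ring

theorem sumL_step (hq : ∑ i : Fin N, p i.succ = 1 - p 0) (htsum : ∑ i, t i = 1)
    (hw : ∀ i, 0 < w i) (σ : List (Fin N)) (h : ℕ) :
    ∑ ω : Fin (h + 1) → Fin N, mu1 p t (σ ++ List.ofFn ω) *
        Real.log (aword w (σ ++ List.ofFn ω)) =
      ∑ ω : Fin h → Fin N, mu1 p t (σ ++ List.ofFn ω) * Real.log (aword w (σ ++ List.ofFn ω))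
      + p 0 * (pword p σ * ((1 - p 0) ^ h * Real.log (aword w σ) +
        h * (1 - p 0) ^ (h - 1) * ∑ i, p i.succ * Real.log (w i)))
      + (mu1 p t σ + pword p σ * (1 - (1 - p 0) ^ (h + 1))) * ∑ i, t i * Real.log (w i) := by
  rw [sum_ext_step (fun τ => mu1 p t τ * Real.log (aword w τ))]
  have key : ∀ τ : List (Fin N),
      ∑ i, mu1 p t (τ ++ [i]) * Real.log (aword w (τ ++ [i])) =
      mu1 p t τ * Real.log (aword w τ) + p 0 * (pword p τ * Real.log (aword w τ)) +
        (mu1 p t τ + p 0 * pword p τ) * ∑ i, t i * Real.log (w i) := by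
    intro τ
    have e : mu1 p t τ * Real.log (aword w τ) + p 0 * (pword p τ * Real.log (aword w τ)) =
        ((mu1 p t τ + p 0 * pword p τ) * Real.log (aword w τ)) * ∑ i, t i := by
      rw [htsum]; ring
    rw [e, Finset.mul_sum, Finset.mul_sum, ← Finset.sum_add_distrib]
    refine Finset.sum_congr rfl fun i _ => ?_
    rw [mu1_snoc, log_snoc w hw]; ring
  simp only [key]
  rw [Finset.sum_add_distrib, Finset.sum_add_distrib, ← Finset.mul_sum, ← Finset.sum_mul,
    Finset.sum_add_distrib, ← Finset.mul_sum, sumP p hq, sumM p t hq htsum, sumK p w hq hw]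
  ring

theorem sumL (hq : ∑ i : Fin N, p i.succ = 1 - p 0) (htsum : ∑ i, t i = 1)
    (hw : ∀ i, 0 < w i) (σ : List (Fin N)) (k : ℕ) :
    ∑ ω : Fin (k + 1) → Fin N, mu1 p t (σ ++ List.ofFn ω) *
        Real.log (aword w (σ ++ List.ofFn ω)) =
      mu1 p t σ * Real.log (aword w σ) + Delta p t w σ (k + 1) := by
  induction k with
  | zero =>
    rw [sumL_step p t w hq htsum hw]
    simp [Delta]
    ring
  | succ k ih =>
    rw [sumL_step p t w hq htsum hw, ih]
    unfold Delta
    rw [Finset.sum_Icc_succ_top (show 2 ≤ k + 1 + 1 by omega),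
      Finset.sum_Icc_succ_top (show 2 ≤ k + 1 + 1 by omega)]
    simp only [Nat.add_sub_cancel, show k + 1 + 1 - 2 = k by omega]
    push_cast
    ring
end

theorem stmt15 (N : ℕ) (hN : 2 ≤ N)
    (p : Fin (N + 1) → ℝ) (hp : ∀ i, 0 < p i) (hpsum : ∑ i, p i = 1)
    (t : Fin N → ℝ) (ht : ∀ i, 0 < t i) (htsum : ∑ i, t i = 1)
    (s : Fin N → ℝ) (hs : ∀ i, s i ∈ Set.Ioo (0 : ℝ) 1) :
    ∀ σ : List (Fin N), σ ≠ [] → ∀ h : ℕ, 1 ≤ h →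
      (∑ ω : Fin h → Fin N,
          mu1 p t (σ ++ List.ofFn ω) * Real.log (aword t (σ ++ List.ofFn ω)) =
        mu1 p t σ * Real.log (aword t σ) + Delta p t t σ h) ∧
      (∑ ω : Fin h → Fin N,
          mu1 p t (σ ++ List.ofFn ω) * Real.log (aword s (σ ++ List.ofFn ω)) =
        mu1 p t σ * Real.log (aword s σ) + Delta p t s σ h) := by
  have hq : ∑ i : Fin N, p i.succ = 1 - p 0 := by
    rw [Fin.sum_univ_succ] at hpsum; linarith
  intro σ _ h hh
  obtain ⟨k, rfl⟩ := Nat.exists_eq_add_of_le' hh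
  exact ⟨sumL p t t hq htsum ht σ k, sumL p t s hq htsum (fun i => (hs i).1) σ k⟩
end
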